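/- Let ω ∈ ℝ, let m : (0,∞) → (0,∞) be continuously differentiable, and consider the one-degree-of-freedom position-dependent-mass oscillator Hamiltonian H(q,p) = p²/(2m(q)) + (1/2)m(q)ω²q². Let (q(t),p(t)) be a solution of Hamilton's equations dq/dt = p/m(q), dp/dt = (m'(q)/(2m(q)²))p² − (1/2)ω² d/dq(m(q)q²), with q(t) > 0 for all t, and define the complex function A(t) = p(t)/√(m(q(t))) + i ω √(m(q(t))) q(t). Then A satisfies dA/dt = i ω (1 + q(t) m'(q(t))/(2 m(q(t)))) A. In particular, |A|²/2 = p²/(2m(q)) + (1/2)m(q)ω²q² = H is constant along the solution. -/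

import Mathlib

/-- Along any solution of Hamilton's equations for the one-degree-of-freedom
position-dependent-mass oscillator `H(q,p) = p²/(2m(q)) + (1/2)m(q)ω²q²` with `q(t) > 0`,
the complex function `A(t) = p(t)/√(m(q(t))) + i ω √(m(q(t))) q(t)` satisfies
`dA/dt = i ω (1 + q m'(q)/(2m(q))) A`; in particular `|A|²/2` equals the energy
`p²/(2m(q)) + (1/2)m(q)ω²q²`, which is constant along the solution. -/
theorem pdm_oscillator_complex_factorization
    (ω : ℝ) (m : ℝ → ℝ) (hm : ∀ x > (0 : ℝ), 0 < m x)
    (hm' : ContDiffOn ℝ 1 m (Set.Ioi 0))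
    (q p : ℝ → ℝ) (hq : ∀ t, 0 < q t)
    (hq' : ∀ t, HasDerivAt q (p t / m (q t)) t)
    (hp' : ∀ t, HasDerivAt p
      (deriv m (q t) / (2 * (m (q t))^2) * (p t)^2
        - (1/2) * ω^2 * (deriv m (q t) * (q t)^2 + 2 * m (q t) * q t)) t) :
    (∀ t, HasDerivAt
        (fun t => ((p t / Real.sqrt (m (q t)) : ℝ) : ℂ)
          + Complex.I * (ω : ℂ) * (Real.sqrt (m (q t)) : ℂ) * (q t : ℂ))
        (Complex.I * (ω : ℂ) * ((1 : ℂ) + (q t : ℂ) * ((deriv m (q t) : ℝ) : ℂ) / (2 * (m (q t) : ℂ)))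
          * (((p t / Real.sqrt (m (q t)) : ℝ) : ℂ)
              + Complex.I * (ω : ℂ) * (Real.sqrt (m (q t)) : ℂ) * (q t : ℂ))) t) ∧
    (∀ t, ‖((p t / Real.sqrt (m (q t)) : ℝ) : ℂ)
            + Complex.I * (ω : ℂ) * (Real.sqrt (m (q t)) : ℂ) * (q t : ℂ)‖ ^ 2 / 2
          = (p t)^2 / (2 * m (q t)) + (1/2) * m (q t) * ω^2 * (q t)^2) ∧
    (∀ t s, (p t)^2 / (2 * m (q t)) + (1/2) * m (q t) * ω^2 * (q t)^2
          = (p s)^2 / (2 * m (q s)) + (1/2) * m (q s) * ω^2 * (q s)^2) := by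
  have hM : ∀ t, 0 < m (q t) := fun t => hm _ (hq t)
  have hs : ∀ t, 0 < Real.sqrt (m (q t)) := fun t => Real.sqrt_pos.2 (hM t)
  have hsq : ∀ t, m (q t) = Real.sqrt (m (q t)) ^ 2 := fun t => (Real.sq_sqrt (hM t).le).symm
  have hmq : ∀ t, HasDerivAt (fun t => m (q t)) (deriv m (q t) * (p t / m (q t))) t := fun t =>
    HasDerivAt.comp t (((hm'.differentiableOn one_ne_zero).differentiableAt
      (Ioi_mem_nhds (hq t))).hasDerivAt) (hq' t)
  have hre : ∀ t, HasDerivAt (fun t => p t / Real.sqrt (m (q t)))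
      (-(ω ^ 2 * (1 + q t * deriv m (q t) / (2 * m (q t))) * (Real.sqrt (m (q t)) * q t))) t := by
    intro t
    refine ((hp' t).div ((hmq t).sqrt (hM t).ne') (hs t).ne').congr_deriv ?_
    have h := hs t
    have h2 := hsq t
    generalize Real.sqrt (m (q t)) = s at h h2 ⊢
    rw [h2]
    field_simp
    ring
  have him : ∀ t, HasDerivAt (fun t => Real.sqrt (m (q t)) * q t)
      ((1 + q t * deriv m (q t) / (2 * m (q t))) * (p t / Real.sqrt (m (q t)))) t := by
    intro t
    refine (((hmq t).sqrt (hM t).ne').mul (hq' t)).congr_deriv ?_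
    have h := hs t
    have h2 := hsq t
    generalize Real.sqrt (m (q t)) = s at h h2 ⊢
    rw [h2]
    field_simp
    ring
  have henergy : ∀ t, (p t)^2 / (2 * m (q t)) + (1/2) * m (q t) * ω^2 * (q t)^2
      = ((p t / Real.sqrt (m (q t))) ^ 2 + ω ^ 2 * (Real.sqrt (m (q t)) * q t) ^ 2) / 2 := by
    intro t
    rw [div_pow, mul_pow, Real.sq_sqrt (hM t).le]
    have h := (hM t).ne'
    field_simp
  refine ⟨fun t => ?_, fun t => ?_, fun t s => ?_⟩
  · have h := (hre t).ofReal_comp.add ((him t).ofReal_comp.const_mul (Complex.I * (ω : ℂ)))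
    refine (h.congr_deriv ?_).congr_of_eventuallyEq (Filter.Eventually.of_forall fun u => ?_)
    · push_cast
      linear_combination (-(ω : ℂ) ^ 2 * (1 + (q t : ℂ) * ((deriv m (q t) : ℝ) : ℂ) / (2 * (m (q t) : ℂ)))
        * ((Real.sqrt (m (q t)) : ℂ) * (q t : ℂ))) * Complex.I_sq
    · simp only [Pi.add_apply]
      push_cast
      ring
  · have h : ((p t / Real.sqrt (m (q t)) : ℝ) : ℂ)
        + Complex.I * (ω : ℂ) * (Real.sqrt (m (q t)) : ℂ) * (q t : ℂ)
        = ((p t / Real.sqrt (m (q t)) : ℝ) : ℂ)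
          + ((ω * (Real.sqrt (m (q t)) * q t) : ℝ) : ℂ) * Complex.I := by
      push_cast
      ring
    rw [h, henergy, ← Complex.normSq_eq_norm_sq, Complex.normSq_add_mul_I, mul_pow]
  · rw [henergy, henergy]
    have h : ∀ u, HasDerivAt (fun u => ((p u / Real.sqrt (m (q u))) ^ 2
        + ω ^ 2 * (Real.sqrt (m (q u)) * q u) ^ 2) / 2) 0 u := by
      intro u
      refine ((((hre u).pow 2).add (((him u).pow 2).const_mul (ω ^ 2))).div_const 2).congr_deriv ?_
      push_cast
      ring
    exact is_const_of_deriv_eq_zero (fun u => (h u).differentiableAt) (fun u => (h u).deriv) t s
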